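/- The original smoothing function s₃^{♯}(r) = erf(r) − (2/9)·r·(9 + 6r² − 36r⁴ + 8r⁶)·e^{−r²}/√π satisfies the second moment condition ∫₀^∞ r²(s₃^{♯}(r) − 1) dr = 0. -/

import Mathlib

open MeasureTheory Real Filter

/-- The error function `erf(r) = (2/√π) ∫₀^r e^{−t²} dt`. -/
noncomputable def erf (r : ℝ) : ℝ :=
  (2 / Real.sqrt Real.pi) * ∫ t in (0:ℝ)..r, Real.exp (-t ^ 2)

/-- The original high-order smoothing function
`s₃^{♯}(r) = erf(r) − (2/9)r(9 + 6r² − 36r⁴ + 8r⁶)e^{−r²}/√π`. -/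
noncomputable def s3SharpOrig (r : ℝ) : ℝ :=
  erf r - (2 / 9) * r * (9 + 6 * r ^ 2 - 36 * r ^ 4 + 8 * r ^ 6) * Real.exp (-r ^ 2) /
    Real.sqrt Real.pi

lemma exp_neg_sq_le_exp_neg_two_mul (r : ℝ) : exp (-r ^ 2) ≤ exp 1 * exp (-2 * r) := by
  rw [← exp_add, exp_le_exp]
  nlinarith [sq_nonneg (r - 1)]

lemma integrable_exp_neg_sq : Integrable fun t : ℝ => exp (-t ^ 2) := by
  simpa using integrable_exp_neg_mul_sq (zero_lt_one (α := ℝ))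

lemma one_sub_erf (r : ℝ) : 1 - erf r = 2 / √π * ∫ t in Set.Ioi r, exp (-t ^ 2) := by
  have h := intervalIntegral.integral_interval_add_Ioi
    (integrable_exp_neg_sq.integrableOn (s := Set.Ioi (0 : ℝ)))
    (integrable_exp_neg_sq.integrableOn (s := Set.Ioi r))
  have hg : ∫ t in Set.Ioi (0 : ℝ), exp (-t ^ 2) = √π / 2 := by
    simpa using integral_gaussian_Ioi 1
  have hπ : √π ≠ 0 := by positivity
  rw [hg] at h
  rw [erf, sub_eq_iff_eq_add, ← mul_add, add_comm, h]
  field_simp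

lemma hasDerivAt_erf (r : ℝ) : HasDerivAt erf (2 / √π * exp (-r ^ 2)) r := by
  have hc : Continuous fun t : ℝ => exp (-t ^ 2) := by fun_prop
  exact (hc.integral_hasStrictDerivAt 0 r).hasDerivAt.const_mul _

lemma exp_neg_sq_isBigO : (fun r : ℝ => exp (-r ^ 2)) =O[atTop] fun r => exp (-2 * r) := by
  refine Asymptotics.IsBigO.of_bound (exp 1) (.of_forall fun r => ?_)
  simpa only [norm_eq_abs, abs_exp] using exp_neg_sq_le_exp_neg_two_mul r

lemma erf_sub_one_isBigO : (fun r : ℝ => erf r - 1) =O[atTop] fun r => exp (-2 * r) := by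
  refine Asymptotics.IsBigO.of_bound (2 / √π * (exp 1 / 2)) (.of_forall fun r => ?_)
  have hle : ∫ t in Set.Ioi r, exp (-t ^ 2) ≤ ∫ t in Set.Ioi r, exp 1 * exp (-2 * t) :=
    setIntegral_mono integrable_exp_neg_sq.integrableOn
      ((integrableOn_exp_mul_Ioi (by norm_num) r).const_mul _) exp_neg_sq_le_exp_neg_two_mul
  rw [integral_const_mul, integral_exp_mul_Ioi (by norm_num)] at hle
  have hnn : 0 ≤ ∫ t in Set.Ioi r, exp (-t ^ 2) := integral_nonneg fun t => (exp_pos _).le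
  rw [norm_sub_rev, one_sub_erf, norm_of_nonneg (by positivity), norm_of_nonneg (exp_pos _).le,
    mul_assoc]
  gcongr
  linarith

lemma pow_mul_isBigO_exp_neg {g : ℝ → ℝ} (hg : g =O[atTop] fun r => exp (-2 * r)) (n : ℕ) :
    (fun r => r ^ n * g r) =O[atTop] fun r => exp (-1 * r) := by
  have h := (isLittleO_pow_exp_atTop (n := n)).isBigO.mul hg
  refine h.congr_right fun r => ?_
  rw [← exp_add]
  ring_nf

/-- An antiderivative of `r ^ 2 * (s3SharpOrig r - 1)` vanishing at `0` and at infinity. -/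
noncomputable def secondMomentPrimitive (r : ℝ) : ℝ :=
  r ^ 3 / 3 * (erf r - 1) +
    (-(2 / 3) * r ^ 4 - 4 / 9 * r ^ 6 + 8 / 9 * r ^ 8) * (exp (-r ^ 2) / √π)

lemma hasDerivAt_secondMomentPrimitive (r : ℝ) :
    HasDerivAt secondMomentPrimitive (r ^ 2 * (s3SharpOrig r - 1)) r := by
  have he : HasDerivAt (fun r : ℝ => exp (-r ^ 2)) (exp (-r ^ 2) * -(2 * r)) r := by
    simpa using ((hasDerivAt_pow 2 r).neg).exp
  have hp := ((((hasDerivAt_pow 4 r).const_mul (-(2 / 3 : ℝ))).sub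
    ((hasDerivAt_pow 6 r).const_mul (4 / 9 : ℝ))).add ((hasDerivAt_pow 8 r).const_mul (8 / 9 : ℝ)))
  have h := (((hasDerivAt_pow 3 r).div_const 3).mul ((hasDerivAt_erf r).sub_const 1)).add
    (hp.mul (he.div_const √π))
  refine h.congr_deriv ?_
  simp only [s3SharpOrig, Pi.add_apply, Pi.sub_apply]
  push_cast
  ring

lemma secondMomentPrimitive_isBigO :
    secondMomentPrimitive =O[atTop] fun r => exp (-1 * r) := by
  have h (n : ℕ) (c : ℝ) := (pow_mul_isBigO_exp_neg exp_neg_sq_isBigO n).const_mul_left c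
  refine ((((pow_mul_isBigO_exp_neg erf_sub_one_isBigO 3).const_mul_left (1 / 3)).add
    (h 4 (-(2 / 3) / √π))).add ((h 6 (-(4 / 9) / √π)).add (h 8 (8 / 9 / √π)))).congr_left
    fun r => ?_
  rw [secondMomentPrimitive]
  ring

lemma sq_mul_s3SharpOrig_sub_one_isBigO :
    (fun r => r ^ 2 * (s3SharpOrig r - 1)) =O[atTop] fun r => exp (-1 * r) := by
  have h (n : ℕ) (c : ℝ) := (pow_mul_isBigO_exp_neg exp_neg_sq_isBigO n).const_mul_left c
  refine (((pow_mul_isBigO_exp_neg erf_sub_one_isBigO 2).add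
    (h 3 (-2 / √π))).add (((h 5 (-(4 / 3) / √π)).add (h 7 (8 / √π))).add
    (h 9 (-(16 / 9) / √π)))).congr_left fun r => ?_
  rw [s3SharpOrig]
  ring

lemma continuous_s3SharpOrig : Continuous s3SharpOrig := by
  have he : Continuous erf := continuous_iff_continuousAt.2 fun r => (hasDerivAt_erf r).continuousAt
  unfold s3SharpOrig
  fun_prop

/-- `∫₀^∞ r²(s₃^{♯}(r) − 1) dr = 0` for the original high-order smoothing function. -/
theorem second_moment_s3SharpOrig :
    ∫ r in Set.Ioi (0:ℝ), r ^ 2 * (s3SharpOrig r - 1) = 0 := by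
  have hint : IntegrableOn (fun r => r ^ 2 * (s3SharpOrig r - 1)) (Set.Ioi 0) :=
    integrable_of_isBigO_exp_neg one_pos
      (((continuous_pow 2).mul (continuous_s3SharpOrig.sub continuous_const)).continuousOn)
      sq_mul_s3SharpOrig_sub_one_isBigO
  have hlim : Tendsto secondMomentPrimitive atTop (nhds 0) := by
    refine secondMomentPrimitive_isBigO.trans_tendsto ?_
    simpa using tendsto_exp_neg_atTop_nhds_zero
  rw [integral_Ioi_of_hasDerivAt_of_tendsto' (fun r _ => hasDerivAt_secondMomentPrimitive r)
    hint hlim]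
  simp [secondMomentPrimitive]
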